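/- arXiv:1807.04430 — 2 statements merged into one kernel-verified Lean document; each statement's English description precedes it below -/
import Mathlib

section
/- Let $d \ge 2$ and let $A_\alpha(x,y,z) := \alpha\,\big(\tfrac{-y}{x^2+y^2}, \tfrac{x}{x^2+y^2}, 0, \dots, 0\big)$ be the Aharonov–Bohm vector potential on $\mathbb{R}^d$ with $\alpha \in \mathbb{R}$. Then for every smooth compactly supported function $\psi : \mathbb{R}^d \to \mathbb{C}$ whose support is disjoint from the set $\{x = y = 0\}$, one has $\int_{\mathbb{R}^d} |\nabla\psi + i A_\alpha \psi|^2 \ge \Big(\frac{d-2}{2}\Big)^2 \int_{\mathbb{R}^d} \frac{|\psi|^2}{x^2+y^2+|z|^2} + \operatorname{dist}(\alpha,\mathbb{Z})^2 \int_{\mathbb{R}^d} \frac{|\psi|^2}{x^2+y^2}$. -/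
open MeasureTheory Complex

theorem ab_circle (α β : ℝ) (hβ : 0 ≤ β) (hαβ : ∀ m : ℤ, β ≤ |α - m|) (f f' : ℝ → ℂ)
    (hf : ∀ t, HasDerivAt f (f' t) t) (hf' : Continuous f')
    (hper : f (2 * Real.pi) = f 0) :
    β ^ 2 * ∫ t in (0:ℝ)..(2 * Real.pi), ‖f t‖ ^ 2 ≤
      ∫ t in (0:ℝ)..(2 * Real.pi), ‖f' t + I * α * f t‖ ^ 2 := by
  have hpos : (0:ℝ) < 2 * Real.pi := by positivity
  have hfc : Continuous f := continuous_iff_continuousAt.2 fun t => (hf t).continuousAt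
  have hmem : ∀ g : ℝ → ℂ, Continuous g →
      MemLp g 2 (volume.restrict (Set.Ioc 0 (2 * Real.pi))) := by
    intro g hg
    obtain ⟨C, hC⟩ := (isCompact_Icc (a := (0:ℝ)) (b := 2 * Real.pi)).exists_bound_of_continuousOn
      hg.continuousOn
    refine MemLp.of_bound hg.aestronglyMeasurable C ?_
    refine (ae_restrict_iff' measurableSet_Ioc).2 (Filter.Eventually.of_forall fun x hx => ?_)
    exact hC x ⟨hx.1.le, hx.2⟩
  have hgc : Continuous fun t => f' t + I * α * f t := by fun_prop
  have h1 := hasSum_sq_fourierCoeffOn hpos (hmem f hfc)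
  have h2 := hasSum_sq_fourierCoeffOn hpos (hmem _ hgc)
  have hcoef' : ∀ n : ℤ, fourierCoeffOn hpos f' n = I * n * fourierCoeffOn hpos f n := by
    intro n
    by_cases hn : n = 0
    · subst hn
      rw [fourierCoeffOn_eq_integral]
      simp only [neg_zero, fourier_zero, one_smul, Int.cast_zero, mul_zero, zero_mul]
      rw [intervalIntegral.integral_eq_sub_of_hasDerivAt (fun t _ => hf t)
        (hf'.intervalIntegrable _ _), hper]
      simp
    · rw [fourierCoeffOn_of_hasDerivAt hpos hn (fun t _ => hf t) (hf'.intervalIntegrable _ _), hper]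
      have : (Real.pi : ℂ) ≠ 0 := by exact_mod_cast Real.pi_ne_zero
      have : (n : ℂ) ≠ 0 := by exact_mod_cast hn
      push_cast
      field_simp
      simp only [sub_self, mul_zero, zero_sub, sub_zero]
      ring
  have hcoef : ∀ n : ℤ, fourierCoeffOn hpos (fun t => f' t + I * α * f t) n
      = I * (n + α) * fourierCoeffOn hpos f n := by
    intro n
    have : fourierCoeffOn hpos (fun t => f' t + I * α * f t) n
      = fourierCoeffOn hpos f' n + I * α * fourierCoeffOn hpos f n := by
      simp only [fourierCoeffOn_eq_integral]
      have e : (fun x : ℝ => (fourier (-n)) ((x : ℝ) : AddCircle (2 * Real.pi - 0)) • (f' x + I * α * f x))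
        = fun x : ℝ => (fourier (-n)) ((x : ℝ) : AddCircle (2 * Real.pi - 0)) • f' x
          + (I * α) * ((fourier (-n)) ((x : ℝ) : AddCircle (2 * Real.pi - 0)) • f x) := by
        funext x
        simp only [smul_eq_mul]; ring
      have hfo : Continuous fun x : ℝ => (fourier (-n)) ((x : ℝ) : AddCircle (2 * Real.pi - 0)) :=
        (map_continuous _).comp (AddCircle.continuous_mk' _)
      rw [e, intervalIntegral.integral_add, intervalIntegral.integral_const_mul]
      · simp only [smul_add, Complex.real_smul]; ring
      · exact (hfo.smul hf').intervalIntegrable _ _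
      · exact (continuous_const.mul (hfo.smul hfc)).intervalIntegrable _ _
    rw [this, hcoef']; ring
  have h3 := hasSum_le (fun n => ?_) (h1.mul_left (β ^ 2)) h2
  · simp only [sub_zero, smul_eq_mul] at h3
    have : (0:ℝ) < (2 * Real.pi)⁻¹ := by positivity
    rw [mul_left_comm] at h3
    exact le_of_mul_le_mul_left h3 this
  · rw [hcoef, norm_mul, mul_pow]
    have : ‖I * ((n:ℂ) + α)‖ = |α - ((-n : ℤ) : ℝ)| := by
      rw [norm_mul, norm_I, one_mul]
      have : (n:ℂ) + α = ((α - ((-n : ℤ) : ℝ) : ℝ) : ℂ) := by push_cast; ring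
      rw [this, Complex.norm_real, Real.norm_eq_abs]
    rw [this]
    have := hαβ (-n)
    gcongr

abbrev ABX (n : ℕ) := ℝ × ℝ × EuclideanSpace ℝ (Fin n)

instance ab_haar (n : ℕ) : (volume : Measure (ABX n)).IsAddHaarMeasure := by
  have : (volume : Measure (ℝ × EuclideanSpace ℝ (Fin n))).IsAddHaarMeasure :=
    Measure.prod.instIsAddHaarMeasure _ _
  exact Measure.prod.instIsAddHaarMeasure _ _

theorem ab_cont {X F : Type*} [TopologicalSpace X] [TopologicalSpace F] [Zero F]
    {K : Set X} (hK : IsClosed K) {f : X → F} (h0 : ∀ p ∉ K, f p = 0)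
    (hf : ∀ p ∈ K, ContinuousAt f p) : Continuous f := by
  refine continuous_iff_continuousAt.2 fun p => ?_
  by_cases hp : p ∈ K
  · exact hf p hp
  · have : f =ᶠ[nhds p] fun _ => 0 := by
      filter_upwards [hK.isOpen_compl.mem_nhds hp] with q hq using h0 q hq
    exact continuousAt_const.congr this.symm

theorem ab_integrable {n : ℕ} {F : Type*} [NormedAddCommGroup F]
    {K : Set (ABX n)} (hK : IsCompact K) {f : ABX n → F} (h0 : ∀ p ∉ K, f p = 0)
    (hf : ∀ p ∈ K, ContinuousAt f p) : Integrable f :=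
  (ab_cont hK.isClosed h0 hf).integrable_of_hasCompactSupport (HasCompactSupport.intro hK h0)

theorem ab_decomp {n : ℕ} (p : ABX n) : p = p.1 • ((1, 0, 0) : ABX n) + p.2.1 • ((0, 1, 0) : ABX n)
    + ∑ j, p.2.2 j • ((0, 0, EuclideanSpace.single j 1) : ABX n) := by
  obtain ⟨x, y, z⟩ := p
  have hz : z = ∑ j, z j • EuclideanSpace.single j (1:ℝ) := by
    ext i
    simp [Finset.sum_apply, Pi.single_apply]
  ext1
  · simp [Prod.fst_sum]
  ext1
  · simp [Prod.fst_sum, Prod.snd_sum]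
  · simp [Prod.snd_sum]
    exact hz

theorem ab_lin {n : ℕ} {F : Type*} [NormedAddCommGroup F] [NormedSpace ℝ F]
    (L : ABX n →L[ℝ] F) (p : ABX n) : L p = p.1 • L (1, 0, 0) + p.2.1 • L (0, 1, 0)
      + ∑ j, p.2.2 j • L (0, 0, EuclideanSpace.single j 1) := by
  have := congrArg L (ab_decomp p)
  simpa only [map_add, map_smul, map_sum] using this

theorem ab_ibp {n : ℕ} (h : ABX n → ℝ) (hh : ContDiff ℝ 1 h) (hc : HasCompactSupport h)
    (v : ABX n) (l : ABX n →L[ℝ] ℝ) :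
    Integrable (fun p => l p * fderiv ℝ h p v) ∧
    ∫ p, l p * fderiv ℝ h p v = - (l v * ∫ p, h p) := by
  have hd : Continuous fun p => fderiv ℝ h p v :=
    (hh.continuous_fderiv (by norm_num)).clm_apply continuous_const
  have hdc : HasCompactSupport fun p => fderiv ℝ h p v := hc.fderiv_apply ℝ v
  have hi : Integrable (fun p => l p * fderiv ℝ h p v) :=
    (l.continuous.mul hd).integrable_of_hasCompactSupport hdc.mul_left
  refine ⟨hi, ?_⟩
  rw [integral_mul_fderiv_eq_neg_fderiv_mul_of_integrable]
  · simp [integral_const_mul]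
  · simp only [ContinuousLinearMap.fderiv]
    exact (hh.continuous.integrable_of_hasCompactSupport hc).const_mul _
  · exact hi
  · exact (l.continuous.mul hh.continuous).integrable_of_hasCompactSupport hc.mul_left
  · intro x _; exact l.differentiableAt
  · intro x _; exact hh.differentiable (by norm_num) x

theorem ab_euler {n : ℕ} (h : ABX n → ℝ) (hh : ContDiff ℝ 1 h) (hc : HasCompactSupport h) :
    ∫ p, fderiv ℝ h p p = - ((n + 2) * ∫ p, h p) := by
  have h1 := ab_ibp h hh hc (1, 0, 0) (ContinuousLinearMap.fst ℝ ℝ _)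
  have h2 := ab_ibp h hh hc (0, 1, 0)
    ((ContinuousLinearMap.fst ℝ ℝ _).comp (ContinuousLinearMap.snd ℝ ℝ _))
  have h3 := fun j : Fin n => ab_ibp h hh hc (0, 0, EuclideanSpace.single j 1)
    ((EuclideanSpace.proj j).comp
      ((ContinuousLinearMap.snd ℝ ℝ _).comp (ContinuousLinearMap.snd ℝ ℝ _)))
  have e : ∀ p, fderiv ℝ h p p = p.1 * fderiv ℝ h p (1, 0, 0) + p.2.1 * fderiv ℝ h p (0, 1, 0)
      + ∑ j, p.2.2 j * fderiv ℝ h p (0, 0, EuclideanSpace.single j 1) := by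
    intro p
    exact ab_lin _ p
  simp only [e]
  simp at h1 h2 h3
  have h12 : Integrable fun p : ABX n =>
      p.1 * fderiv ℝ h p (1, 0, 0) + p.2.1 * fderiv ℝ h p (0, 1, 0) := h1.1.add h2.1
  rw [integral_add h12 (integrable_finsetSum _ fun j _ => (h3 j).1),
    integral_add h1.1 h2.1, integral_finsetSum _ fun j _ => (h3 j).1, h1.2, h2.2]
  simp only [fun j => (h3 j).2]
  simp
  ring

theorem ab_hardy {n : ℕ} (ψ : ABX n → ℂ) (hψ : ContDiff ℝ (⊤ : ℕ∞) ψ) (hc : HasCompactSupport ψ)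
    (hs : ∀ p ∈ tsupport ψ, ¬(p.1 = 0 ∧ p.2.1 = 0)) :
    ((n:ℝ) / 2) ^ 2 * (∫ p, ‖ψ p‖ ^ 2 / (p.1 ^ 2 + p.2.1 ^ 2 + ‖p.2.2‖ ^ 2)) ≤
    ∫ p, ‖fderiv ℝ ψ p p‖ ^ 2 / (p.1 ^ 2 + p.2.1 ^ 2 + ‖p.2.2‖ ^ 2) := by
  have hK : IsCompact (tsupport ψ) := hc
  have hψ0 : ∀ p ∉ tsupport ψ, ψ p = 0 := fun p hp => image_eq_zero_of_notMem_tsupport hp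
  have hdψ0 : ∀ p ∉ tsupport ψ, fderiv ℝ ψ p = 0 := fun p hp => by
    have := tsupport_fderiv_subset ℝ (f := ψ)
    exact image_eq_zero_of_notMem_tsupport fun h => hp (this h)
  have hne : ∀ p ∈ tsupport ψ, p.1 ^ 2 + p.2.1 ^ 2 + ‖p.2.2‖ ^ 2 ≠ 0 := by
    intro p hp h
    apply hs p hp
    constructor <;> nlinarith [sq_nonneg p.1, sq_nonneg p.2.1, sq_nonneg ‖p.2.2‖]
  have hdc : Continuous fun p => fderiv ℝ ψ p p :=
    (hψ.continuous_fderiv (by simp)).clm_apply continuous_id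
  have hψc := hψ.continuous
  set R : ABX n → ℝ := fun p => p.1 ^ 2 + p.2.1 ^ 2 + ‖p.2.2‖ ^ 2 with hR
  have hRs : ContDiff ℝ (⊤ : ℕ∞) R := by
    refine ((contDiff_fst.pow 2).add (contDiff_snd.fst.pow 2)).add (contDiff_snd.snd.norm_sq ℝ)
  have hRE : ∀ p, fderiv ℝ R p p = 2 * R p := by
    intro p
    have h1 : HasFDerivAt (fun q : ABX n => q.1) (ContinuousLinearMap.fst ℝ ℝ _) p := hasFDerivAt_fst
    have h2 : HasFDerivAt (fun q : ABX n => q.2.1)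
      ((ContinuousLinearMap.fst ℝ ℝ _).comp (ContinuousLinearMap.snd ℝ ℝ _)) p :=
      (hasFDerivAt_snd (𝕜 := ℝ) (p := p)).fst
    have h3 : HasFDerivAt (fun q : ABX n => q.2.2)
      ((ContinuousLinearMap.snd ℝ ℝ _).comp (ContinuousLinearMap.snd ℝ ℝ _)) p :=
      (hasFDerivAt_snd (𝕜 := ℝ) (p := p)).snd
    have h4 := ((h1.pow 2).add (h2.pow 2)).add h3.norm_sq
    have h5 : HasFDerivAt R _ p := h4
    rw [h5.fderiv]
    simp [hR]
    ring
  have hRc := hRs.continuous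
  have hJ : Integrable fun p => ‖ψ p‖ ^ 2 / R p := by
    refine ab_integrable hK (fun p hp => by simp [hψ0 p hp]) fun p hp => ?_
    exact (by fun_prop : ContinuousAt (fun p => ‖ψ p‖ ^ 2) p).div hRc.continuousAt (hne p hp)
  have hL : Integrable fun p => ‖fderiv ℝ ψ p p‖ ^ 2 / R p := by
    refine ab_integrable hK (fun p hp => by simp [hdψ0 p hp]) fun p hp => ?_
    exact ((hdc.norm.pow 2).continuousAt).div hRc.continuousAt (hne p hp)
  have hM : Integrable fun p => inner ℝ (ψ p) (fderiv ℝ ψ p p) / R p := by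
    refine ab_integrable hK (fun p hp => by simp [hdψ0 p hp]) fun p hp => ?_
    exact ((hψc.inner hdc).continuousAt).div hRc.continuousAt (hne p hp)
  have hsm : ContDiff ℝ 1 (fun p => ‖ψ p‖ ^ 2 / R p) := by
    rw [contDiff_iff_contDiffAt]
    intro p
    by_cases hp : p ∈ tsupport ψ
    · exact (((hψ.norm_sq ℝ).contDiffAt).div hRs.contDiffAt (hne p hp)).of_le (by simp)
    · have : (fun p => ‖ψ p‖ ^ 2 / R p) =ᶠ[nhds p] fun _ => 0 := by
        filter_upwards [hK.isClosed.isOpen_compl.mem_nhds hp] with q hq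
        simp [hψ0 q hq]
      exact contDiffAt_const.congr_of_eventuallyEq this
  have hsc : HasCompactSupport (fun p => ‖ψ p‖ ^ 2 / R p) :=
    HasCompactSupport.intro hK fun p hp => by simp [hψ0 p hp]
  have hE := ab_euler _ hsm hsc
  have hfd : ∀ p, fderiv ℝ (fun p => ‖ψ p‖ ^ 2 / R p) p p
      = 2 * (inner ℝ (ψ p) (fderiv ℝ ψ p p) / R p) - 2 * (‖ψ p‖ ^ 2 / R p) := by
    intro p
    by_cases hp : p ∈ tsupport ψ
    · have h1 : HasFDerivAt ψ (fderiv ℝ ψ p) p := (hψ.differentiable (by simp) p).hasFDerivAt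
      have h2 : HasFDerivAt R (fderiv ℝ R p) p := (hRs.differentiable (by simp) p).hasFDerivAt
      have hn : R p ≠ 0 := hne p hp
      have h3 := h1.norm_sq.mul ((hasDerivAt_inv hn).comp_hasFDerivAt p h2)
      have h4 : HasFDerivAt (fun p => ‖ψ p‖ ^ 2 / R p) _ p := h3
      rw [h4.fderiv]
      simp [hRE]
      field_simp
      ring
    · have : (fun p => ‖ψ p‖ ^ 2 / R p) =ᶠ[nhds p] fun _ => 0 := by
        filter_upwards [hK.isClosed.isOpen_compl.mem_nhds hp] with q hq
        simp [hψ0 q hq]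
      rw [this.fderiv_eq]
      simp [hψ0 p hp]
  simp only [hfd] at hE
  rw [integral_sub (hM.const_mul 2) (hJ.const_mul 2), integral_const_mul, integral_const_mul] at hE
  have hpos : 0 ≤ ∫ p, ‖fderiv ℝ ψ p p + ((n:ℝ) / 2) • ψ p‖ ^ 2 / R p :=
    integral_nonneg fun p => by
      simp only [hR]; positivity
  have e : ∀ p, ‖fderiv ℝ ψ p p + ((n:ℝ) / 2) • ψ p‖ ^ 2 / R p = ‖fderiv ℝ ψ p p‖ ^ 2 / R p
      + n * (inner ℝ (ψ p) (fderiv ℝ ψ p p) / R p) + ((n:ℝ) / 2) ^ 2 * (‖ψ p‖ ^ 2 / R p) := by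
    intro p
    rw [norm_add_sq_real, inner_smul_right, real_inner_comm, norm_smul, mul_pow, Real.norm_eq_abs,
      sq_abs]
    ring
  simp only [e] at hpos
  have hLM : Integrable fun p => ‖fderiv ℝ ψ p p‖ ^ 2 / R p
      + n * (inner ℝ (ψ p) (fderiv ℝ ψ p p) / R p) := hL.add (hM.const_mul _)
  rw [integral_add hLM (hJ.const_mul _), integral_add hL (hM.const_mul _),
    integral_const_mul, integral_const_mul] at hpos
  nlinarith

noncomputable def abR {n : ℕ} (t : ℝ) (p : ABX n) : ABX n :=
  (Real.cos t * p.1 - Real.sin t * p.2.1, Real.sin t * p.1 + Real.cos t * p.2.1, p.2.2)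

theorem abR_mp {n : ℕ} (t : ℝ) : MeasurePreserving (abR (n := n) t) volume volume := by
  have h1 : MeasurePreserving (rotation (Circle.exp t)) volume volume :=
    LinearIsometryEquiv.measurePreserving _
  have h2 := (Complex.volume_preserving_equiv_real_prod).comp
    (h1.comp (Complex.volume_preserving_equiv_real_prod.symm))
  have h3 : MeasurePreserving _ (volume : Measure ((ℝ × ℝ) × EuclideanSpace ℝ (Fin n))) volume :=
    h2.prod (MeasurePreserving.id (volume : Measure (EuclideanSpace ℝ (Fin n))))
  have ha : MeasurePreserving (MeasurableEquiv.prodAssoc (α := ℝ) (β := ℝ)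
    (γ := EuclideanSpace ℝ (Fin n))) volume volume := volume_preserving_prodAssoc
  have h4 := ha.comp (h3.comp ha.symm)
  convert h4 using 1
  funext p
  obtain ⟨x, y, z⟩ := p
  have he : Complex.measurableEquivRealProd.symm (x, y) = ⟨x, y⟩ := rfl
  simp [abR, MeasurableEquiv.prodAssoc, Circle.coe_exp, rotation_apply, he,
    Complex.measurableEquivRealProd_apply, Complex.exp_ofReal_mul_I_re,
    Complex.exp_ofReal_mul_I_im]
  ring

theorem abR_cont {n : ℕ} : Continuous fun q : ℝ × ABX n => abR q.1 q.2 := by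
  unfold abR
  fun_prop

theorem ab_avg {n : ℕ} (F : ABX n → ℝ) (hF : Continuous F) (hi : Integrable F) :
    Integrable (fun p => ∫ t in (0:ℝ)..(2 * Real.pi), F (abR t p)) ∧
    (2 * Real.pi) * ∫ p, F p = ∫ p, ∫ t in (0:ℝ)..(2 * Real.pi), F (abR t p) := by
  have hpos : (0:ℝ) ≤ 2 * Real.pi := by positivity
  have hcomp : ∀ (G : ABX n → ℝ), Continuous G → ∀ t, ∫ p, G (abR t p) = ∫ p, G p := by
    intro G hG t
    conv_rhs => rw [← (abR_mp (n := n) t).map_eq]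
    rw [integral_map (abR_mp t).measurable.aemeasurable hG.aestronglyMeasurable]
  have hint : Integrable (Function.uncurry fun (t : ℝ) (p : ABX n) => F (abR t p))
      ((volume.restrict (Set.Ioc 0 (2 * Real.pi))).prod volume) := by
    have hc : Continuous (Function.uncurry fun (t : ℝ) (p : ABX n) => F (abR t p)) :=
      hF.comp abR_cont
    rw [integrable_prod_iff hc.aestronglyMeasurable]
    refine ⟨Filter.Eventually.of_forall fun t => ?_, ?_⟩
    · exact (abR_mp t).integrable_comp_of_integrable hi
    · simp only [Function.uncurry]
      simp only [fun t => hcomp (fun p => ‖F p‖) hF.norm t]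
      exact integrable_const _
  simp only [intervalIntegral.integral_of_le hpos]
  refine ⟨hint.integral_prod_right, ?_⟩
  rw [← integral_integral_swap hint]
  simp only [hcomp F hF]
  simp [hpos]

theorem ab_angular {n : ℕ} (α β : ℝ) (hβ : 0 ≤ β) (hαβ : ∀ m : ℤ, β ≤ |α - m|)
    (ψ : ABX n → ℂ) (hψ : ContDiff ℝ (⊤ : ℕ∞) ψ) (hc : HasCompactSupport ψ)
    (hs : ∀ p ∈ tsupport ψ, ¬(p.1 = 0 ∧ p.2.1 = 0)) :
    Integrable (fun p : ABX n => ‖fderiv ℝ ψ p (-p.2.1, p.1, 0) + I * α * ψ p‖ ^ 2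
      / (p.1 ^ 2 + p.2.1 ^ 2)) ∧
    β ^ 2 * (∫ p, ‖ψ p‖ ^ 2 / (p.1 ^ 2 + p.2.1 ^ 2)) ≤
    ∫ p : ABX n, ‖fderiv ℝ ψ p (-p.2.1, p.1, 0) + I * α * ψ p‖ ^ 2 / (p.1 ^ 2 + p.2.1 ^ 2) := by
  have hK : IsCompact (tsupport ψ) := hc
  have hψ0 : ∀ p ∉ tsupport ψ, ψ p = 0 := fun p hp => image_eq_zero_of_notMem_tsupport hp
  have hdψ0 : ∀ p ∉ tsupport ψ, fderiv ℝ ψ p = 0 := fun p hp => by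
    have := tsupport_fderiv_subset ℝ (f := ψ)
    exact image_eq_zero_of_notMem_tsupport fun h => hp (this h)
  have hne : ∀ p ∈ tsupport ψ, p.1 ^ 2 + p.2.1 ^ 2 ≠ 0 := by
    intro p hp h
    apply hs p hp
    constructor <;> nlinarith [sq_nonneg p.1, sq_nonneg p.2.1]
  have hψc := hψ.continuous
  have hdc : Continuous fun p : ABX n => fderiv ℝ ψ p (-p.2.1, p.1, 0) :=
    (hψ.continuous_fderiv (by simp)).clm_apply (by fun_prop)
  have hRc : Continuous fun p : ABX n => p.1 ^ 2 + p.2.1 ^ 2 := by fun_prop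
  have h10 : ∀ p ∉ tsupport ψ, ‖fderiv ℝ ψ p (-p.2.1, p.1, 0) + I * α * ψ p‖ ^ 2
      / (p.1 ^ 2 + p.2.1 ^ 2) = 0 := fun p hp => by simp [hψ0 p hp, hdψ0 p hp]
  have h1c : ∀ p ∈ tsupport ψ, ContinuousAt (fun p : ABX n =>
      ‖fderiv ℝ ψ p (-p.2.1, p.1, 0) + I * α * ψ p‖ ^ 2 / (p.1 ^ 2 + p.2.1 ^ 2)) p := fun p hp =>
    (((hdc.add (continuous_const.mul hψc)).norm.pow 2).continuousAt).div hRc.continuousAt (hne p hp)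
  have h20 : ∀ p ∉ tsupport ψ, ‖ψ p‖ ^ 2 / (p.1 ^ 2 + p.2.1 ^ 2) = 0 :=
    fun p hp => by simp [hψ0 p hp]
  have h2c : ∀ p ∈ tsupport ψ, ContinuousAt (fun p : ABX n =>
      ‖ψ p‖ ^ 2 / (p.1 ^ 2 + p.2.1 ^ 2)) p := fun p hp =>
    ((hψc.norm.pow 2).continuousAt).div hRc.continuousAt (hne p hp)
  have i1 := ab_integrable hK h10 h1c
  have i2 := ab_integrable hK h20 h2c
  refine ⟨i1, ?_⟩
  have a1 := ab_avg _ (ab_cont hK.isClosed h10 h1c) i1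
  have a2 := ab_avg _ (ab_cont hK.isClosed h20 h2c) i2
  have hpos : (0:ℝ) < 2 * Real.pi := by positivity
  refine le_of_mul_le_mul_left ?_ hpos
  rw [mul_left_comm, a1.2, a2.2, ← integral_const_mul]
  refine integral_mono (a2.1.const_mul _) a1.1 fun p => ?_
  have hrho : ∀ t, (abR t p).1 ^ 2 + (abR t p).2.1 ^ 2 = p.1 ^ 2 + p.2.1 ^ 2 := by
    intro t
    simp only [abR]
    linear_combination (p.1 ^ 2 + p.2.1 ^ 2) * Real.sin_sq_add_cos_sq t
  have hder : ∀ t, HasDerivAt (fun t => abR t p) (-(abR t p).2.1, (abR t p).1, 0) t := by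
    intro t
    have hc := Real.hasDerivAt_cos t
    have hs := Real.hasDerivAt_sin t
    have := ((hc.mul_const p.1).sub (hs.mul_const p.2.1)).prodMk
      (((hs.mul_const p.1).add (hc.mul_const p.2.1)).prodMk (hasDerivAt_const t p.2.2))
    have e : ((-(abR t p).2.1, (abR t p).1, 0) : ABX n) = (-Real.sin t * p.1 - Real.cos t * p.2.1,
        Real.cos t * p.1 + -Real.sin t * p.2.1, 0) := by
      simp only [abR, Prod.mk.injEq]
      exact ⟨by ring, by ring, trivial⟩
    rw [e]
    exact this
  have hRt : Continuous fun t => abR t p := abR_cont.comp (by fun_prop : Continuous fun t => (t, p))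
  have key := ab_circle α β hβ hαβ (fun t => ψ (abR t p))
    (fun t => fderiv ℝ ψ (abR t p) (-(abR t p).2.1, (abR t p).1, 0))
    (fun t => (hψ.differentiable (by simp) _).hasFDerivAt.comp_hasDerivAt t (hder t))
    (hdc.comp hRt) (by simp [abR])
  simp only [hrho, intervalIntegral.integral_div]
  rw [← mul_div_assoc]
  gcongr

theorem ab_pointwise {n : ℕ} (α x y : ℝ) (z : EuclideanSpace ℝ (Fin n)) (hρ : x ^ 2 + y ^ 2 ≠ 0)
    (u v w : ℂ) (c : Fin n → ℂ) :
    ‖x • u + y • v + ∑ j, z j • c j‖ ^ 2 / (x ^ 2 + y ^ 2 + ‖z‖ ^ 2)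
      + ‖(-y) • u + x • v + I * α * w‖ ^ 2 / (x ^ 2 + y ^ 2)
    ≤ ‖u + I * Complex.ofReal (α * (-y) / (x ^ 2 + y ^ 2)) * w‖ ^ 2
      + ‖v + I * Complex.ofReal (α * x / (x ^ 2 + y ^ 2)) * w‖ ^ 2 + ∑ j, ‖c j‖ ^ 2 := by
  have hρ' : 0 < x ^ 2 + y ^ 2 := lt_of_le_of_ne (by positivity) hρ.symm
  have hρC : (x:ℂ) ^ 2 + (y:ℂ) ^ 2 ≠ 0 := by exact_mod_cast hρ
  set a := u + I * Complex.ofReal (α * (-y) / (x ^ 2 + y ^ 2)) * w with ha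
  set b := v + I * Complex.ofReal (α * x / (x ^ 2 + y ^ 2)) * w with hb
  have e1 : x • u + y • v = x • a + y • b := by
    simp only [Complex.real_smul, ha, hb]
    push_cast
    ring
  have e2 : (-y) • u + x • v + I * α * w = x • b - y • a := by
    simp only [Complex.real_smul, ha, hb]
    push_cast
    field_simp
    ring
  have e3 : (x ^ 2 + y ^ 2) * (‖a‖ ^ 2 + ‖b‖ ^ 2) = ‖x • a + y • b‖ ^ 2 + ‖x • b - y • a‖ ^ 2 := by
    simp only [← Complex.normSq_eq_norm_sq, Complex.normSq_apply]
    simp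
    ring
  rw [e1, e2]
  have hz : ‖z‖ ^ 2 = ∑ j, z j ^ 2 := by
    rw [EuclideanSpace.norm_sq_eq]; simp
  have hS : ‖∑ j, z j • c j‖ ^ 2 ≤ ‖z‖ ^ 2 * ∑ j, ‖c j‖ ^ 2 := by
    calc ‖∑ j, z j • c j‖ ^ 2 ≤ (∑ j, ‖z j‖ * ‖c j‖) ^ 2 := by
          gcongr
          refine (norm_sum_le _ _).trans_eq ?_
          simp [norm_smul]
      _ ≤ (∑ j, ‖z j‖ ^ 2) * ∑ j, ‖c j‖ ^ 2 := Finset.sum_mul_sq_le_sq_mul_sq _ _ _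
      _ = _ := by rw [EuclideanSpace.norm_sq_eq]
  set s := ∑ j, z j • c j
  set T := ∑ j, ‖c j‖ ^ 2
  have hT : 0 ≤ T := Finset.sum_nonneg fun _ _ => by positivity
  set r := x ^ 2 + y ^ 2
  set A := ‖x • a + y • b‖
  have h5 : ‖x • a + y • b + s‖ ^ 2 / (r + ‖z‖ ^ 2) ≤ A ^ 2 / r + T := by
    rw [div_le_iff₀ (by positivity)]
    have hA : 0 ≤ A := norm_nonneg _
    have h6 : ‖x • a + y • b + s‖ ^ 2 ≤ (A + ‖s‖) ^ 2 := by
      gcongr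
      exact norm_add_le _ _
    have h7 : 2 * A * ‖s‖ ≤ A ^ 2 / r * ‖z‖ ^ 2 + T * r := by
      have h8 : (A * ‖s‖) ^ 2 ≤ (A ^ 2 / r * ‖z‖ ^ 2) * (T * r) := by
        have : (A ^ 2 / r * ‖z‖ ^ 2) * (T * r) = A ^ 2 * (‖z‖ ^ 2 * T) := by field_simp
        rw [this, mul_pow]
        gcongr
      have hP : 0 ≤ A ^ 2 / r * ‖z‖ ^ 2 := by positivity
      have hQ : 0 ≤ T * r := by positivity
      refine abs_le_of_sq_le_sq' ?_ (by positivity) |>.2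
      nlinarith [sq_nonneg (A ^ 2 / r * ‖z‖ ^ 2 - T * r)]
    have h9 : (A ^ 2 / r + T) * (r + ‖z‖ ^ 2)
        = A ^ 2 + A ^ 2 / r * ‖z‖ ^ 2 + T * r + ‖z‖ ^ 2 * T := by
      field_simp
      ring
    rw [h9]
    nlinarith
  have h10 : ‖a‖ ^ 2 + ‖b‖ ^ 2 = A ^ 2 / r + ‖x • b - y • a‖ ^ 2 / r := by
    rw [← add_div, eq_div_iff hρ, ← e3]; ring
  linarith

/-- Sharp Hardy inequality for the Aharonov–Bohm field
`A_α = α (-y/(x²+y²), x/(x²+y²), 0, …, 0)` on `ℝ^d`, `d ≥ 2`: for every smooth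
compactly supported `ψ` with support disjoint from `{x = y = 0}`,
`∫ |∇ψ + iA_αψ|² ≥ ((d-2)/2)² ∫ |ψ|²/r² + dist(α,ℤ)² ∫ |ψ|²/ρ²`,
where `r² = x² + y² + |z|²` and `ρ² = x² + y²`. -/
theorem aharonov_bohm_hardy (d : ℕ) (hd : 2 ≤ d) (α : ℝ)
    (ψ : ℝ × ℝ × EuclideanSpace ℝ (Fin (d - 2)) → ℂ)
    (hψ : ContDiff ℝ (⊤ : ℕ∞) ψ) (hc : HasCompactSupport ψ)
    (hs : ∀ p ∈ tsupport ψ, ¬(p.1 = 0 ∧ p.2.1 = 0)) :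
    ∫ p : ℝ × ℝ × EuclideanSpace ℝ (Fin (d - 2)),
        (‖fderiv ℝ ψ p (1, 0, 0)
            + Complex.I * Complex.ofReal (α * (-p.2.1) / (p.1 ^ 2 + p.2.1 ^ 2)) * ψ p‖ ^ 2
          + ‖fderiv ℝ ψ p (0, 1, 0)
              + Complex.I * Complex.ofReal (α * p.1 / (p.1 ^ 2 + p.2.1 ^ 2)) * ψ p‖ ^ 2
          + ∑ j : Fin (d - 2), ‖fderiv ℝ ψ p (0, 0, EuclideanSpace.single j 1)‖ ^ 2)
      ≥ (((d : ℝ) - 2) / 2) ^ 2 *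
          (∫ p : ℝ × ℝ × EuclideanSpace ℝ (Fin (d - 2)),
            ‖ψ p‖ ^ 2 / (p.1 ^ 2 + p.2.1 ^ 2 + ‖p.2.2‖ ^ 2))
        + (⨅ m : ℤ, |α - (m : ℝ)|) ^ 2 *
          ∫ p : ℝ × ℝ × EuclideanSpace ℝ (Fin (d - 2)),
            ‖ψ p‖ ^ 2 / (p.1 ^ 2 + p.2.1 ^ 2) := by
  obtain ⟨n, rfl⟩ : ∃ n, d = n + 2 := ⟨d - 2, by omega⟩
  have hn : (((n + 2 : ℕ) : ℝ) - 2) / 2 = ((n + 2 - 2 : ℕ) : ℝ) / 2 := by simp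
  rw [hn]
  generalize n + 2 - 2 = k at ψ
  set β := ⨅ m : ℤ, |α - (m : ℝ)| with hβdef
  have hβ : 0 ≤ β := Real.iInf_nonneg fun m => abs_nonneg _
  have hαβ : ∀ m : ℤ, β ≤ |α - m| := fun m =>
    ciInf_le ⟨0, by rintro _ ⟨m, rfl⟩; exact abs_nonneg _⟩ m
  have H1 := ab_hardy ψ hψ hc hs
  obtain ⟨hi2, H2⟩ := ab_angular α β hβ hαβ ψ hψ hc hs
  have hK : IsCompact (tsupport ψ) := hc
  have hψ0 : ∀ p ∉ tsupport ψ, ψ p = 0 := fun p hp => image_eq_zero_of_notMem_tsupport hp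
  have hdψ0 : ∀ p ∉ tsupport ψ, fderiv ℝ ψ p = 0 := fun p hp => by
    have := tsupport_fderiv_subset ℝ (f := ψ)
    exact image_eq_zero_of_notMem_tsupport fun h => hp (this h)
  have hne : ∀ p ∈ tsupport ψ, p.1 ^ 2 + p.2.1 ^ 2 ≠ 0 := by
    intro p hp h
    apply hs p hp
    constructor <;> nlinarith [sq_nonneg p.1, sq_nonneg p.2.1]
  have hψc := hψ.continuous
  have hd1 : ∀ v, Continuous fun p => fderiv ℝ ψ p v := fun v =>
    (hψ.continuous_fderiv (by simp)).clm_apply continuous_const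
  have hdc : Continuous fun p => fderiv ℝ ψ p p :=
    (hψ.continuous_fderiv (by simp)).clm_apply continuous_id
  have hi1 : Integrable fun p => ‖fderiv ℝ ψ p p‖ ^ 2 / (p.1 ^ 2 + p.2.1 ^ 2 + ‖p.2.2‖ ^ 2) := by
    refine ab_integrable hK (fun p hp => by simp [hdψ0 p hp]) fun p hp => ?_
    refine ((hdc.norm.pow 2).continuousAt).div (by fun_prop) ?_
    have := hne p hp
    positivity
  refine ge_iff_le.2 ((add_le_add H1 H2).trans ?_)
  rw [← integral_add hi1 hi2]
  refine integral_mono (hi1.add hi2) ?_ fun p => ?_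
  · refine ab_integrable hK (fun p hp => by simp [hψ0 p hp, hdψ0 p hp]) fun p hp => ?_
    have hp' := hne p hp
    have c1 : ContinuousAt (fun p : ABX k =>
        Complex.ofReal (α * (-p.2.1) / (p.1 ^ 2 + p.2.1 ^ 2))) p :=
      Complex.continuous_ofReal.continuousAt.comp
        (ContinuousAt.div (by fun_prop) (by fun_prop) hp')
    have c2 : ContinuousAt (fun p : ABX k =>
        Complex.ofReal (α * p.1 / (p.1 ^ 2 + p.2.1 ^ 2))) p :=
      Complex.continuous_ofReal.continuousAt.comp
        (ContinuousAt.div (by fun_prop) (by fun_prop) hp')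
    refine ((((hd1 _).continuousAt.add ((continuousAt_const.mul c1).mul hψc.continuousAt)).norm.pow
      2).add (((hd1 _).continuousAt.add
        ((continuousAt_const.mul c2).mul hψc.continuousAt)).norm.pow 2)).add ?_
    exact (continuous_finsetSum _ fun j _ => (hd1 _).norm.pow 2).continuousAt
  · by_cases hp : p ∈ tsupport ψ
    · have := ab_pointwise α p.1 p.2.1 p.2.2 (hne p hp) (fderiv ℝ ψ p (1, 0, 0))
        (fderiv ℝ ψ p (0, 1, 0)) (ψ p) (fun j => fderiv ℝ ψ p (0, 0, EuclideanSpace.single j 1))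
      have l1 := ab_lin (fderiv ℝ ψ p) p
      have l2 := ab_lin (fderiv ℝ ψ p) (-p.2.1, p.1, 0)
      simp only [PiLp.zero_apply, zero_smul, Finset.sum_const_zero, add_zero] at l2
      rw [← l1, ← l2] at this
      exact this
    · simp [hψ0 p hp, hdψ0 p hp]
end

section
/- Let $A_\beta(x,y,z) := \beta\,\big(\tfrac{y}{z^2}, 0, 0\big)$ on $\mathbb{R}^3$ with $\beta \in \mathbb{R}$. For every $\lambda \ge 0$ and every $\varepsilon > 0$ there exists a nonzero smooth compactly supported function $\psi : \mathbb{R}^3 \to \mathbb{C}$, with support disjoint from the plane $\{z = 0\}$, such that $\| -\Delta\psi - 2i\tfrac{\beta}{z^2} y\, \partial_x \psi + \tfrac{\beta^2}{z^4} y^2 \psi - \lambda \psi \|_{L^2(\mathbb{R}^3)} \le \varepsilon \|\psi\|_{L^2(\mathbb{R}^3)}$. Consequently, every $\lambda \ge 0$ lies in the spectrum of the magnetic Laplacian $-\Delta_\beta := (-i\nabla + A_\beta)^2$. -/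
open MeasureTheory Complex

/-- plane wave in the `y` direction -/
noncomputable def wave (k : ℝ) (p : ℝ × ℝ × ℝ) : ℂ := cexp (I * (k * p.2.1 : ℝ))

lemma norm_wave (k : ℝ) (p : ℝ × ℝ × ℝ) : ‖wave k p‖ = 1 := by
  unfold wave
  rw [mul_comm]
  exact Complex.norm_exp_ofReal_mul_I _

lemma contDiff_wave (k : ℝ) : ContDiff ℝ (⊤ : ℕ∞) (wave k) := by
  unfold wave
  apply ContDiff.cexp
  apply ContDiff.mul contDiff_const
  have h : ContDiff ℝ (⊤ : ℕ∞) (fun p : ℝ × ℝ × ℝ => k * p.2.1) := by fun_prop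
  exact ofRealCLM.contDiff.comp h

lemma hasFDerivAt_wave (k : ℝ) (p v : ℝ × ℝ × ℝ) :
    fderiv ℝ (wave k) p v = I * (k * v.2.1 : ℝ) * wave k p := by
  let L : ℝ × ℝ × ℝ →L[ℝ] ℝ :=
    k • ((ContinuousLinearMap.fst ℝ ℝ ℝ).comp (ContinuousLinearMap.snd ℝ ℝ (ℝ × ℝ)))
  have h1 : HasFDerivAt (fun p : ℝ × ℝ × ℝ => (((ofRealCLM.comp L) p : ℂ))) (ofRealCLM.comp L) p :=
    (ofRealCLM.comp L).hasFDerivAt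
  have h2 := (h1.const_mul I).cexp
  have h3 : wave k = fun p : ℝ × ℝ × ℝ => cexp (I * (ofRealCLM.comp L) p) := by
    funext p; simp [wave, L]
  rw [h3, h2.fderiv]
  simp [L]
  ring

lemma fderiv_scale (s k : ℝ) (Φ : ℝ × ℝ × ℝ → ℂ) (hΦ : ContDiff ℝ (⊤ : ℕ∞) Φ)
    (v p : ℝ × ℝ × ℝ) :
    fderiv ℝ (fun p => Φ (s • p) * wave k p) p v
      = (fun q => (s : ℂ) * fderiv ℝ Φ q v + I * (k * v.2.1 : ℝ) * Φ q) (s • p) * wave k p := by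
  have hd : Differentiable ℝ Φ := hΦ.differentiable (by simp)
  have hs : HasFDerivAt (fun p : ℝ × ℝ × ℝ => s • p)
      (s • ContinuousLinearMap.id ℝ (ℝ × ℝ × ℝ)) p := (hasFDerivAt_id p).const_smul s
  have h1 : HasFDerivAt (fun p => Φ (s • p)) _ p := (hd (s • p)).hasFDerivAt.comp p hs
  have hw : HasFDerivAt (wave k) (fderiv ℝ (wave k) p) p :=
    ((contDiff_wave k).differentiable (by simp) p).hasFDerivAt
  have h2 : HasFDerivAt (fun p => Φ (s • p) * wave k p) _ p := h1.mul hw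
  rw [h2.fderiv]
  simp [hasFDerivAt_wave]
  ring

lemma contDiff_dir (Φ : ℝ × ℝ × ℝ → ℂ) (hΦ : ContDiff ℝ (⊤ : ℕ∞) Φ) (v : ℝ × ℝ × ℝ) :
    ContDiff ℝ (⊤ : ℕ∞) (fun q => fderiv ℝ Φ q v) := by
  have := hΦ.fderiv_right (m := (⊤ : ℕ∞)) (by simp)
  fun_prop

lemma fderiv2_scale (s k : ℝ) (Φ : ℝ × ℝ × ℝ → ℂ) (hΦ : ContDiff ℝ (⊤ : ℕ∞) Φ)
    (v p : ℝ × ℝ × ℝ) :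
    fderiv ℝ (fun p => fderiv ℝ (fun p => Φ (s • p) * wave k p) p v) p v
      = ((s : ℂ) ^ 2 * fderiv ℝ (fun q => fderiv ℝ Φ q v) (s • p) v
        + 2 * s * (I * (k * v.2.1 : ℝ)) * fderiv ℝ Φ (s • p) v
        - ((k * v.2.1 : ℝ) : ℂ) ^ 2 * Φ (s • p)) * wave k p := by
  have h0 := contDiff_dir Φ hΦ v
  have h1 : ContDiff ℝ (⊤ : ℕ∞)
      (fun q => (s : ℂ) * fderiv ℝ Φ q v + I * (k * v.2.1 : ℝ) * Φ q) := by fun_prop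
  rw [funext (fderiv_scale s k Φ hΦ v), fderiv_scale s k _ h1 v p]
  have a1 : HasFDerivAt (fun q => fderiv ℝ Φ q v)
    (fderiv ℝ (fun q => fderiv ℝ Φ q v) (s • p)) (s • p) :=
    (h0.differentiable (by simp) _).hasFDerivAt
  have a2 : HasFDerivAt Φ (fderiv ℝ Φ (s • p)) (s • p) :=
    (hΦ.differentiable (by simp) _).hasFDerivAt
  have a3 : HasFDerivAt (fun q => (s : ℂ) * fderiv ℝ Φ q v + I * (k * v.2.1 : ℝ) * Φ q) _ (s • p) :=
    (a1.const_mul (s : ℂ)).add (a2.const_mul (I * (k * v.2.1 : ℝ)))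
  beta_reduce
  rw [a3.fderiv]
  simp only [add_apply, smul_apply, smul_eq_mul]
  linear_combination (((k * v.2.1 : ℝ) : ℂ) ^ 2 * Φ (s • p) * wave k p) * I_sq

lemma hcs_sq (F : ℝ × ℝ × ℝ → ℝ) (sF : HasCompactSupport F) :
    HasCompactSupport (fun q => F q ^ 2) :=
  sF.comp_left (g := fun t : ℝ => t ^ 2) (by simp)

instance haar3 : (volume : Measure (ℝ × ℝ × ℝ)).IsAddHaarMeasure := by
  have h : (volume : Measure (ℝ × ℝ)).IsAddHaarMeasure := by
    rw [Measure.volume_eq_prod]; infer_instance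
  rw [Measure.volume_eq_prod]
  infer_instance

lemma exists_profile : ∃ Φ : ℝ × ℝ × ℝ → ℂ, ContDiff ℝ (⊤ : ℕ∞) Φ ∧ HasCompactSupport Φ ∧
    (∀ q ∈ tsupport Φ, |q.2.1| ≤ 2 ∧ 1 ≤ q.2.2) ∧ Φ (0, 0, 3) = 1 := by
  let b : ContDiffBump ((0, 0, 3) : ℝ × ℝ × ℝ) := ⟨1, 2, by norm_num, by norm_num⟩
  have hts : tsupport (fun q => ((b q : ℝ) : ℂ)) ⊆ tsupport b :=
    tsupport_comp_subset (g := fun t : ℝ => (t : ℂ)) (by simp) _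
  refine ⟨fun q => ((b q : ℝ) : ℂ), ofRealCLM.contDiff.comp b.contDiff, ?_, ?_, ?_⟩
  · exact b.hasCompactSupport.comp_left (g := fun t : ℝ => (t : ℂ)) (by simp)
  · intro q hq
    have h := hts hq
    rw [b.tsupport_eq, Metric.mem_closedBall] at h
    change dist q (0, 0, 3) ≤ 2 at h
    simp only [Prod.dist_eq, Real.dist_eq, sup_le_iff, sub_zero] at h
    refine ⟨h.2.1, ?_⟩
    have := (abs_le.1 h.2.2).1
    linarith
  · have : b (0, 0, 3) = 1 := b.one_of_mem_closedBall (by simp [b])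
    simp [this]

set_option maxHeartbeats 1000000 in
theorem weyl_sequence_confining (β lam : ℝ) (hlam : 0 ≤ lam) (ε : ℝ) (hε : 0 < ε) :
    ∃ ψ : ℝ × ℝ × ℝ → ℂ, ψ ≠ 0 ∧ ContDiff ℝ (⊤ : ℕ∞) ψ ∧ HasCompactSupport ψ ∧
      (∀ p ∈ tsupport ψ, p.2.2 ≠ 0) ∧
      Real.sqrt (∫ p : ℝ × ℝ × ℝ,
          ‖-(fderiv ℝ (fun q => fderiv ℝ ψ q (1, 0, 0)) p (1, 0, 0)
              + fderiv ℝ (fun q => fderiv ℝ ψ q (0, 1, 0)) p (0, 1, 0)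
              + fderiv ℝ (fun q => fderiv ℝ ψ q (0, 0, 1)) p (0, 0, 1))
            - 2 * Complex.I * Complex.ofReal (β / p.2.2 ^ 2 * p.2.1)
                * fderiv ℝ ψ p (1, 0, 0)
            + Complex.ofReal (β ^ 2 / p.2.2 ^ 4 * p.2.1 ^ 2) * ψ p
            - Complex.ofReal lam * ψ p‖ ^ 2)
        ≤ ε * Real.sqrt (∫ p : ℝ × ℝ × ℝ, ‖ψ p‖ ^ 2) := by
  obtain ⟨Φ, hΦ, hc, hsupp, h1⟩ := exists_profile
  set k := Real.sqrt lam with hk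
  have hk2 : k ^ 2 = lam := Real.sq_sqrt hlam
  have hk0 : 0 ≤ k := Real.sqrt_nonneg _
  let D : ℝ × ℝ × ℝ → ℝ × ℝ × ℝ → ℂ := fun v q => fderiv ℝ Φ q v
  let D2 : ℝ × ℝ × ℝ → ℝ × ℝ × ℝ → ℂ := fun v q => fderiv ℝ (fun q => fderiv ℝ Φ q v) q v
  have cD : ∀ v, Continuous (D v) := fun v => (contDiff_dir Φ hΦ v).continuous
  have cD2 : ∀ v, Continuous (D2 v) := fun v =>
    (contDiff_dir _ (contDiff_dir Φ hΦ v) v).continuous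
  have sD : ∀ v, HasCompactSupport (D v) := fun v => hc.fderiv_apply ℝ v
  have sD2 : ∀ v, HasCompactSupport (D2 v) := fun v =>
    HasCompactSupport.fderiv_apply ℝ (hc.fderiv_apply ℝ v) v
  let F : ℝ × ℝ × ℝ → ℝ := fun q => ‖D2 (1,0,0) q‖ + ‖D2 (0,1,0) q‖ + ‖D2 (0,0,1) q‖
    + 2 * k * ‖D (0,1,0) q‖ + 4 * |β| * ‖D (1,0,0) q‖ + 4 * β ^ 2 * ‖Φ q‖
  have cF : Continuous F := by
    have := cD (0,1,0); have := cD (1,0,0)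
    have := cD2 (1,0,0); have := cD2 (0,1,0); have := cD2 (0,0,1)
    have := hΦ.continuous
    fun_prop
  have sF : HasCompactSupport F :=
    (((((sD2 _).norm.add (sD2 _).norm).add (sD2 _).norm).add
      ((sD (0,1,0)).norm.mul_left (f := fun _ => 2 * k))).add
      ((sD (1,0,0)).norm.mul_left (f := fun _ => 4 * |β|))).add
      (hc.norm.mul_left (f := fun _ => 4 * β ^ 2))
  have iF : Integrable (fun q => F q ^ 2) :=
    (cF.pow 2).integrable_of_hasCompactSupport (hcs_sq F sF)
  have posΦ : 0 < ∫ q, ‖Φ q‖ ^ 2 := by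
    apply Continuous.integral_pos_of_hasCompactSupport_nonneg_nonzero (x := (0, 0, 3))
    · exact (hΦ.continuous.norm.pow 2)
    · exact hcs_sq _ hc.norm
    · intro q; positivity
    · simp [h1]
  set A := ∫ q, F q ^ 2 with hA
  set B := ∫ q, ‖Φ q‖ ^ 2 with hB
  obtain ⟨n, hn1, hn⟩ : ∃ n : ℝ, 1 ≤ n ∧ Real.sqrt A ≤ n * (ε * Real.sqrt B) := by
    have hpos : 0 < ε * Real.sqrt B := mul_pos hε (Real.sqrt_pos.2 posΦ)
    refine ⟨max 1 (Real.sqrt A / (ε * Real.sqrt B)), le_max_left _ _, ?_⟩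
    rw [← div_le_iff₀ hpos]
    exact le_max_right _ _
  have hn0 : 0 < n := by linarith
  set s := n⁻¹ with hs
  have hs0 : 0 < s := inv_pos.2 hn0
  have hs1 : s ≤ 1 := inv_le_one_of_one_le₀ hn1
  have hscale : ∀ G : ℝ × ℝ × ℝ → ℝ, ∫ p, G (s • p) = n ^ 3 * ∫ q, G q := by
    intro G
    rw [Measure.integral_comp_smul]
    have : Module.finrank ℝ (ℝ × ℝ × ℝ) = 3 := by simp
    rw [this, smul_eq_mul, hs, abs_of_pos (by positivity)]
    simp
  have hcs : HasCompactSupport (fun p => Φ (s • p)) :=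
    hc.comp_homeomorph (Homeomorph.smulOfNeZero s hs0.ne')
  refine ⟨fun p => Φ (s • p) * wave k p, ?_, ?_, ?_, ?_, ?_⟩
  · intro h
    have := congrFun h (n • (0, 0, 3))
    have hw : wave k (n • (0, 0, 3)) ≠ 0 := by
      rw [← norm_ne_zero_iff, norm_wave]; norm_num
    rw [smul_smul, hs, inv_mul_cancel₀ hn0.ne', one_smul, h1, one_mul] at this
    exact hw this
  · exact (hΦ.comp (contDiff_const_smul s)).mul (contDiff_wave k)
  · exact hcs.mul_right
  · intro p hp
    have h2 : p ∈ tsupport (fun p => Φ (s • p)) := tsupport_mul_subset_left hp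
    have h3 : s • p ∈ tsupport Φ :=
      tsupport_comp_subset_preimage Φ (continuous_const_smul s) h2
    have := (hsupp _ h3).2
    intro h0
    simp [h0] at this
    linarith
  · have hnorm : ∀ p, ‖Φ (s • p) * wave k p‖ ^ 2 = (fun q => ‖Φ q‖ ^ 2) (s • p) := by
      intro p; simp [norm_wave]
    simp only [hnorm]
    rw [hscale (fun q => ‖Φ q‖ ^ 2)]
    have key : ∀ p : ℝ × ℝ × ℝ, ‖-(fderiv ℝ (fun q => fderiv ℝ (fun p => Φ (s • p) * wave k p) q (1, 0, 0)) p (1, 0, 0)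
              + fderiv ℝ (fun q => fderiv ℝ (fun p => Φ (s • p) * wave k p) q (0, 1, 0)) p (0, 1, 0)
              + fderiv ℝ (fun q => fderiv ℝ (fun p => Φ (s • p) * wave k p) q (0, 0, 1)) p (0, 0, 1))
            - 2 * Complex.I * Complex.ofReal (β / p.2.2 ^ 2 * p.2.1)
                * fderiv ℝ (fun p => Φ (s • p) * wave k p) p (1, 0, 0)
            + Complex.ofReal (β ^ 2 / p.2.2 ^ 4 * p.2.1 ^ 2) * (Φ (s • p) * wave k p)
            - Complex.ofReal lam * (Φ (s • p) * wave k p)‖ ≤ s * F (s • p) := by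
      intro p
      rw [fderiv2_scale s k Φ hΦ, fderiv2_scale s k Φ hΦ, fderiv2_scale s k Φ hΦ,
        fderiv_scale s k Φ hΦ]
      set q := s • p with hq
      have e1 : β / p.2.2 ^ 2 * p.2.1 = s * (β * (q.2.1 / q.2.2 ^ 2)) := by
        simp only [hq, Prod.smul_snd, Prod.smul_fst, smul_eq_mul]
        by_cases hz : p.2.2 = 0
        · simp [hz]
        · field_simp
      set r := q.2.1 / q.2.2 ^ 2 with hr
      have e2 : β ^ 2 / p.2.2 ^ 4 * p.2.1 ^ 2 = (s * (β * r)) ^ 2 := by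
        rw [← e1]; ring
      have hrb : q ∈ tsupport Φ → |r| ≤ 2 := by
        intro h
        obtain ⟨ha, hb⟩ := hsupp q h
        rw [hr, abs_div, abs_of_pos (by positivity : 0 < q.2.2 ^ 2), div_le_iff₀ (by positivity)]
        nlinarith
      have bD : |r| * ‖D (1,0,0) q‖ ≤ 2 * ‖D (1,0,0) q‖ := by
        by_cases h : q ∈ tsupport Φ
        · exact mul_le_mul_of_nonneg_right (hrb h) (norm_nonneg _)
        · have : D (1,0,0) q = 0 := by
            simp only [D]
            rw [fderiv_of_notMem_tsupport (𝕜 := ℝ) h]; simp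
          simp [this]
      have bΦ : r ^ 2 * ‖Φ q‖ ≤ 4 * ‖Φ q‖ := by
        by_cases h : q ∈ tsupport Φ
        · apply mul_le_mul_of_nonneg_right _ (norm_nonneg _)
          have := hrb h
          rw [← sq_abs]
          nlinarith [abs_nonneg r]
        · simp [image_eq_zero_of_notMem_tsupport h]
      rw [e1, e2]
      have e3 : (lam : ℂ) = (k : ℂ) ^ 2 := by rw [← hk2]; push_cast; rfl
      rw [e3]
      calc _ = ‖(-((s:ℂ) ^ 2 * D2 (1,0,0) q) - (s:ℂ) ^ 2 * D2 (0,1,0) q - (s:ℂ) ^ 2 * D2 (0,0,1) q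
            - 2 * s * (I * k) * D (0,1,0) q - 2 * I * (s * (β * r)) * (s * D (1,0,0) q)
            + (s * (β * r)) ^ 2 * Φ q) * wave k p‖ := by
              congr 1
              simp only [D, D2]
              push_cast
              ring
        _ ≤ s ^ 2 * ‖D2 (1,0,0) q‖ + s ^ 2 * ‖D2 (0,1,0) q‖ + s ^ 2 * ‖D2 (0,0,1) q‖
            + 2 * s * k * ‖D (0,1,0) q‖ + 2 * (s * (|β| * |r|)) * (s * ‖D (1,0,0) q‖)
            + (s * (|β| * |r|)) ^ 2 * ‖Φ q‖ := by
              rw [norm_mul, norm_wave, mul_one]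
              refine (norm_add_le _ _).trans (add_le_add ?_ ?_)
              · refine (norm_sub_le _ _).trans (add_le_add ?_ ?_)
                · refine (norm_sub_le _ _).trans (add_le_add ?_ ?_)
                  · refine (norm_sub_le _ _).trans (add_le_add ?_ ?_)
                    · refine (norm_sub_le _ _).trans (add_le_add ?_ ?_)
                      · simp
                      · simp
                    · simp
                  · simp [abs_of_pos hs0, abs_of_nonneg hk0]
                · simp [abs_of_pos hs0]
              · simp [abs_of_pos hs0]
        _ ≤ s * F q := by
              have hss : s ^ 2 ≤ s := by nlinarith
              have t1 := mul_le_mul_of_nonneg_right hss (norm_nonneg (D2 (1,0,0) q))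
              have t2 := mul_le_mul_of_nonneg_right hss (norm_nonneg (D2 (0,1,0) q))
              have t3 := mul_le_mul_of_nonneg_right hss (norm_nonneg (D2 (0,0,1) q))
              have t4 : s ^ 2 * (2 * |β| * (|r| * ‖D (1,0,0) q‖))
                  ≤ s * (2 * |β| * (2 * ‖D (1,0,0) q‖)) := by gcongr
              have t5 : s ^ 2 * (β ^ 2 * (r ^ 2 * ‖Φ q‖)) ≤ s * (β ^ 2 * (4 * ‖Φ q‖)) := by
                gcongr
              have e5 : (s * (|β| * |r|)) ^ 2 = s ^ 2 * (β ^ 2 * r ^ 2) := by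
                rw [mul_pow, mul_pow, sq_abs, sq_abs]
              rw [e5]
              simp only [F]
              nlinarith
    have hint : Integrable (fun p => s ^ 2 * F (s • p) ^ 2) :=
      ((integrable_comp_smul_iff volume (fun q => F q ^ 2) hs0.ne').2 iF).const_mul _
    refine (Real.sqrt_le_sqrt (integral_mono_of_nonneg (μ := volume)
      (g := fun p => s ^ 2 * F (s • p) ^ 2) (Filter.Eventually.of_forall fun p => sq_nonneg _) hint
      (Filter.Eventually.of_forall fun p => ?_))).trans ?_
    · have := pow_le_pow_left₀ (norm_nonneg _) (key p) 2
      rw [mul_pow] at this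
      exact this
    rw [integral_const_mul, hscale (fun q => F q ^ 2), ← hA, ← hB]
    rw [Real.sqrt_mul (by positivity), Real.sqrt_mul (by positivity), Real.sqrt_mul (by positivity),
      Real.sqrt_sq hs0.le]
    calc s * (Real.sqrt (n ^ 3) * Real.sqrt A)
        ≤ s * (Real.sqrt (n ^ 3) * (n * (ε * Real.sqrt B))) := by gcongr
      _ = (s * n) * (ε * (Real.sqrt (n ^ 3) * Real.sqrt B)) := by ring
      _ = _ := by rw [hs, inv_mul_cancel₀ hn0.ne', one_mul]
end
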